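/- (Generalization bound for vector-valued support vector regression.) Let ε ≥ 0 and c(y,a) = max(‖y − a‖_Y − ε, 0). Assume ‖y‖_Y ≤ C_y for P-almost every (x,y) ∈ X×Y. Assume that for every n and every sample z ∈ (X×Y)^n whose outputs have norm at most C_y there is a unique global minimizer f_z ∈ H of f ↦ (1/n)∑_{k=1}^n c(y_k, ev x_k f) + λ‖f‖_H², and that the resulting maps z ↦ f_z and ((x,y), z) ↦ c(y, ev x f_z) are measurable. Then for every m ≥ 1 and 0 < δ ≤ 1, with probability at least 1 − δ over a sample z drawn from P^{⊗m}: ∫ c(y, ev x f_z) dP(x,y) ≤ (1/m)∑_{k=1}^m c(y_k, ev x_k f_z) + (1/m)·κ²/λ + (1/√m)·(2κ²/λ + C_y(1 + κ/√λ))·√(ln(1/δ)/2). -/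

import Mathlib

open MeasureTheory
open scoped InnerProductSpace


open ProbabilityTheory Real in
lemma two_mul_exp_sub_one_le {y : ℝ} (hy : 0 ≤ y) : 2 * (exp y - 1) ≤ y * (exp y + 1) := by
  have hd : ∀ x : ℝ, HasDerivAt (fun y => y * (exp y + 1) - 2 * (exp y - 1))
      (1 * (exp x + 1) + x * exp x - 2 * exp x) x := fun x =>
    ((hasDerivAt_id x).mul ((hasDerivAt_exp x).add_const 1)).sub
      (((hasDerivAt_exp x).sub_const 1).const_mul 2)
  have hmono := monotone_of_hasDerivAt_nonneg
    (f' := fun x => 1 * (exp x + 1) + x * exp x - 2 * exp x)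
    hd (fun x => by
      have h := mul_le_mul_of_nonneg_right (add_one_le_exp (-x)) (exp_pos x).le
      rw [← exp_add, neg_add_cancel, exp_zero] at h
      simp only [Pi.zero_apply]
      linarith)
  have := hmono hy
  simp only [exp_zero] at this
  linarith

/-- If `Z` lies between `L` and `L * exp x`, the chord bound for the positive part is at most
`x / 4` times `Z`. -/
lemma sub_mul_sub_le_of_exp_ratio {L Z x : ℝ} (hL : 0 < L) (hx : 0 ≤ x) :
    (Z - L) * (L * Real.exp x - Z) ≤ x / 4 * Z * (L * Real.exp x - L) ∨ Z < 0 := by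
  rcases lt_or_ge Z 0 with hZ | hZ
  · exact Or.inr hZ
  left
  set E := Real.exp (x / 2) with hE
  have hEx : Real.exp x = E ^ 2 := by rw [hE, ← Real.exp_nat_mul]; congr 1; push_cast; ring
  have hE1 : 1 ≤ E := Real.one_le_exp (by positivity)
  have h := two_mul_exp_sub_one_le (y := x / 2) (by positivity)
  rw [← hE] at h
  have h2 : (E - 1) ^ 2 ≤ x / 4 * (E ^ 2 - 1) := by nlinarith
  rw [hEx]
  nlinarith [sq_nonneg (Z - E * L), mul_le_mul_of_nonneg_left h2 (mul_nonneg hZ hL.le)]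

/-- Decorrelation under exponential tilting: a function with values in `[0, M]` has, under the law
tilted by `exp (u * a)`, a mean that is lower by at most `u * r * M / 4`, where `r` bounds the
oscillation of `a`. -/
lemma integral_exp_mul_sub_le {Ω : Type*} [MeasurableSpace Ω] (P : Measure Ω)
    [IsProbabilityMeasure P] {a S : Ω → ℝ} (ha : Measurable a) (hS : Measurable S) {r M u : ℝ}
    (har : ∀ w w', a w - a w' ≤ r) (hS0 : ∀ w, 0 ≤ S w) (hSM : ∀ w, S w ≤ M) (hu : 0 ≤ u) :
    ∫ w, Real.exp (u * a w) * ((∫ w', S w' ∂P) - S w) ∂P ≤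
      u * r * M / 4 * ∫ w, Real.exp (u * a w) ∂P := by
  obtain ⟨w₀⟩ : Nonempty Ω := nonempty_of_isProbabilityMeasure P
  have hM : 0 ≤ M := (hS0 w₀).trans (hSM w₀)
  have hr : 0 ≤ r := by simpa using har w₀ w₀
  obtain ⟨α, hα, hαr⟩ : ∃ α, (∀ w, α ≤ a w) ∧ ∀ w, a w ≤ α + r := by
    have : Nonempty Ω := ⟨w₀⟩
    have hb : BddBelow (Set.range a) :=
      ⟨a w₀ - r, by rintro _ ⟨w, rfl⟩; linarith [har w₀ w]⟩
    refine ⟨⨅ w, a w, fun w => ciInf_le hb w, fun w => ?_⟩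
    have : a w - r ≤ ⨅ w, a w := le_ciInf fun w' => by linarith [har w w']
    linarith
  set h : Ω → ℝ := fun w => Real.exp (u * a w) with hh
  have hhm : Measurable h := Real.measurable_exp.comp (ha.const_mul u)
  set L := Real.exp (u * α) with hL
  set U := L * Real.exp (u * r) with hU
  have hLpos : 0 < L := Real.exp_pos _
  have hLh : ∀ w, L ≤ h w := fun w =>
    Real.exp_le_exp.2 (mul_le_mul_of_nonneg_left (hα w) hu)
  have hhU : ∀ w, h w ≤ U := fun w => by
    rw [hU, hL, ← Real.exp_add]
    exact Real.exp_le_exp.2 (by nlinarith [mul_le_mul_of_nonneg_left (hαr w) hu])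
  have hSi : Integrable S P := .of_mem_Icc 0 M hS.aemeasurable (ae_of_all _ fun w => ⟨hS0 w, hSM w⟩)
  have hhi : Integrable h P := .of_mem_Icc L U hhm.aemeasurable (ae_of_all _ fun w => ⟨hLh w, hhU w⟩)
  have hhSi : Integrable (fun w => h w * S w) P :=
    .of_mem_Icc 0 (U * M) (hhm.mul hS).aemeasurable (ae_of_all _ fun w =>
      ⟨mul_nonneg (Real.exp_pos _).le (hS0 w),
        mul_le_mul (hhU w) (hSM w) (hS0 w) (hLpos.le.trans ((hLh w).trans (hhU w)))⟩)
  set Z := ∫ w, h w ∂P with hZ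
  have hLZ : L ≤ Z := by
    simpa using integral_mono (integrable_const L) hhi hLh
  have hZU : Z ≤ U := by
    simpa using integral_mono hhi (integrable_const U) hhU
  have hswap : ∫ w, h w * ((∫ w', S w' ∂P) - S w) ∂P = ∫ w, (Z - h w) * S w ∂P := by
    simp_rw [mul_sub, sub_mul]
    rw [integral_sub (hhi.mul_const _) hhSi, integral_sub (hSi.const_mul _) hhSi,
      integral_mul_const, integral_const_mul]
  rw [hswap]
  have hi : Integrable (fun w => (Z - h w) * S w) P := by
    simp_rw [sub_mul]
    exact (hSi.const_mul _).sub hhSi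
  have hpt : ∀ w, (U - L) * ((Z - h w) * S w) ≤ M * (Z - L) * (U - h w) := fun w => by
    have h1 := hLh w
    have h2 := hhU w
    rcases le_total Z (h w) with hc | hc
    · have h3 : (U - L) * ((Z - h w) * S w) ≤ 0 :=
        mul_nonpos_of_nonneg_of_nonpos (by linarith)
          (mul_nonpos_of_nonpos_of_nonneg (by linarith) (hS0 w))
      exact h3.trans (mul_nonneg (mul_nonneg hM (by linarith)) (by linarith))
    · have h3 : (U - L) * (Z - h w) ≤ (Z - L) * (U - h w) := by
        nlinarith [mul_nonneg (sub_nonneg.2 hZU) (sub_nonneg.2 h1)]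
      have h4 : (U - L) * (Z - h w) * S w ≤ (U - L) * (Z - h w) * M :=
        mul_le_mul_of_nonneg_left (hSM w) (mul_nonneg (by linarith) (by linarith))
      nlinarith [mul_le_mul_of_nonneg_right h3 hM]
  have hint : (U - L) * ∫ w, (Z - h w) * S w ∂P ≤ M * (Z - L) * (U - Z) := by
    have := integral_mono (hi.const_mul (U - L))
      (((integrable_const U).sub hhi).const_mul (M * (Z - L))) hpt
    simp only [Pi.sub_apply] at this
    rw [integral_const_mul, integral_const_mul, integral_sub (integrable_const U) hhi] at this
    simpa using this
  have hchord := (sub_mul_sub_le_of_exp_ratio (Z := Z) hLpos (mul_nonneg hu hr)).resolve_right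
    (by linarith)
  rw [← hU] at hchord
  rcases (hLZ.trans hZU).eq_or_lt with hLU | hLU
  · have h0 : ∀ w, (Z - h w) * S w = 0 := fun w => by
      rw [show h w = Z by linarith [hLh w, hhU w], sub_self, zero_mul]
    simp only [h0, integral_zero]
    have := mul_nonneg hu hr
    have := hLpos.le.trans hLZ
    positivity
  · refine le_of_mul_le_mul_left (hint.trans ?_) (sub_pos.2 hLU)
    nlinarith [mul_le_mul_of_nonneg_left hchord hM]

/-- Resampling one coordinate preserves the law of an i.i.d. sample. -/
lemma measurePreserving_update_pi {Ω : Type*} [MeasurableSpace Ω] (P : Measure Ω)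
    [IsProbabilityMeasure P] {m : ℕ} (i : Fin m) :
    MeasurePreserving (fun q : (Fin m → Ω) × Ω => Function.update q.1 i q.2)
      ((Measure.pi fun _ : Fin m => P).prod P) (Measure.pi fun _ : Fin m => P) := by
  refine ⟨measurable_update', (Measure.pi_eq fun s hs => ?_).symm⟩
  rw [Measure.map_apply measurable_update' (MeasurableSet.univ_pi hs)]
  have hpre : (fun q : (Fin m → Ω) × Ω => Function.update q.1 i q.2) ⁻¹' Set.univ.pi s =
      (Set.univ.pi (Function.update s i Set.univ)) ×ˢ s i := by
    ext q
    simp only [Set.mem_preimage, Set.mem_univ_pi, Set.mem_prod]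
    constructor
    · refine fun h => ⟨fun k => ?_, by simpa using h i⟩
      rcases eq_or_ne k i with rfl | hk
      · simp
      · simpa [hk] using h k
    · rintro ⟨h, hi⟩ k
      rcases eq_or_ne k i with rfl | hk
      · simpa using hi
      · simpa [hk] using h k
  rw [hpre, Measure.prod_prod, Measure.pi_pi, ← Finset.prod_erase_mul _ _ (Finset.mem_univ i),
    ← Finset.prod_erase_mul (a := i) (s := Finset.univ) (fun k => P (s k)) (Finset.mem_univ i)]
  congr 1
  rw [Function.update_self, measure_univ, mul_one]
  exact Finset.prod_congr rfl fun k hk => by rw [Function.update_of_ne (Finset.ne_of_mem_erase hk)]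

/-- The generalization gap of a sample-dependent loss `ℓ`: expected loss minus empirical loss. -/
noncomputable def generalizationGap {Ω : Type*} [MeasurableSpace Ω] (P : Measure Ω) {m : ℕ}
    (ℓ : Ω → (Fin m → Ω) → ℝ) (z : Fin m → Ω) : ℝ :=
  ∫ p, ℓ p z ∂P - (1 / (m : ℝ)) * ∑ k, ℓ (z k) z

section UniformStability

variable {Ω : Type*} [MeasurableSpace Ω] {P : Measure Ω} [IsProbabilityMeasure P] {m : ℕ}
  {ℓ : Ω → (Fin m → Ω) → ℝ} {M γ : ℝ}

lemma measurable_loss_self (hℓ : Measurable (Function.uncurry ℓ)) (k : Fin m) :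
    Measurable fun z : Fin m → Ω => ℓ (z k) z :=
  hℓ.comp (f := fun z : Fin m → Ω => (z k, z)) ((measurable_pi_apply k).prodMk measurable_id)

lemma measurable_generalizationGap (hℓ : Measurable (Function.uncurry ℓ)) :
    Measurable (generalizationGap P ℓ) := by
  refine Measurable.sub ?_ (measurable_const.mul (Finset.measurable_sum _ fun k _ => ?_))
  · exact (hℓ.comp measurable_swap).stronglyMeasurable.integral_prod_right'.measurable
  · exact measurable_loss_self hℓ k

lemma integrable_loss (hℓ : Measurable (Function.uncurry ℓ)) (h0 : ∀ p z, 0 ≤ ℓ p z)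
    (hM : ∀ p z, ℓ p z ≤ M) (z : Fin m → Ω) : Integrable (fun p => ℓ p z) P :=
  .of_mem_Icc 0 M (hℓ.comp measurable_prodMk_right).aemeasurable
    (ae_of_all _ fun p => ⟨h0 p z, hM p z⟩)

lemma generalizationGap_mem_Icc (hm : 1 ≤ m) (hℓ : Measurable (Function.uncurry ℓ))
    (h0 : ∀ p z, 0 ≤ ℓ p z) (hM : ∀ p z, ℓ p z ≤ M) (z : Fin m → Ω) :
    generalizationGap P ℓ z ∈ Set.Icc (-M) M := by
  have hmpos : (0 : ℝ) < m := by exact_mod_cast hm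
  have hR0 : 0 ≤ ∫ p, ℓ p z ∂P := integral_nonneg fun p => h0 p z
  have hRM : ∫ p, ℓ p z ∂P ≤ M := by
    simpa using integral_mono (integrable_loss (P := P) hℓ h0 hM z) (integrable_const M)
      fun p => hM p z
  have hE0 : 0 ≤ (1 / (m : ℝ)) * ∑ k, ℓ (z k) z :=
    mul_nonneg (by positivity) (Finset.sum_nonneg fun k _ => h0 _ _)
  have hEM : (1 / (m : ℝ)) * ∑ k, ℓ (z k) z ≤ M := by
    have : ∑ k, ℓ (z k) z ≤ m * M := by
      simpa using Finset.sum_le_sum fun k (_ : k ∈ Finset.univ) => hM (z k) z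
    rw [one_div, inv_mul_le_iff₀ hmpos]
    exact this
  exact ⟨by unfold generalizationGap; linarith, by unfold generalizationGap; linarith⟩

lemma generalizationGap_update_sub_le (hm : 1 ≤ m) (hℓ : Measurable (Function.uncurry ℓ))
    (h0 : ∀ p z, 0 ≤ ℓ p z) (hM : ∀ p z, ℓ p z ≤ M)
    (hγ : ∀ p z i w w', ℓ p (Function.update z i w) ≤ ℓ p (Function.update z i w') + γ)
    (z : Fin m → Ω) (i : Fin m) (w w' : Ω) :
    generalizationGap P ℓ (Function.update z i w) -
      generalizationGap P ℓ (Function.update z i w') ≤ 2 * γ + M / m := by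
  have hmpos : (0 : ℝ) < m := by exact_mod_cast hm
  have hγ0 : 0 ≤ γ := by linarith [hγ w z i w w]
  have hR : ∫ p, ℓ p (Function.update z i w) ∂P ≤ ∫ p, ℓ p (Function.update z i w') ∂P + γ := by
    have := integral_mono (integrable_loss (P := P) hℓ h0 hM (Function.update z i w))
      ((integrable_loss (P := P) hℓ h0 hM (Function.update z i w')).add (integrable_const γ))
      fun p => hγ p z i w w'
    simp only [Pi.add_apply] at this
    rw [integral_add (integrable_loss hℓ h0 hM _) (integrable_const γ)] at this
    simpa using this
  have hE : ∑ k, ℓ (Function.update z i w' k) (Function.update z i w') ≤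
      ∑ k, ℓ (Function.update z i w k) (Function.update z i w) + (m * γ + M) := by
    have : ∀ k ∈ Finset.univ, ℓ (Function.update z i w' k) (Function.update z i w') ≤
        ℓ (Function.update z i w k) (Function.update z i w) + (γ + if k = i then M else 0) := by
      intro k _
      rcases eq_or_ne k i with rfl | hk
      · simp only [if_true]
        linarith [hM (Function.update z k w' k) (Function.update z k w'),
          h0 (Function.update z k w k) (Function.update z k w)]
      · simp only [Function.update_of_ne hk, if_neg hk, add_zero]
        exact hγ _ _ _ _ _
    refine (Finset.sum_le_sum this).trans_eq ?_
    simp [Finset.sum_add_distrib]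
  have hE' := mul_le_mul_of_nonneg_left hE (by positivity : (0 : ℝ) ≤ 1 / m)
  have hsplit : (1 / (m : ℝ)) * (∑ k, ℓ (Function.update z i w k) (Function.update z i w) +
      (m * γ + M)) = (1 / (m : ℝ)) * ∑ k, ℓ (Function.update z i w k) (Function.update z i w) +
      (γ + M / m) := by
    field_simp
  unfold generalizationGap
  linarith

open ProbabilityTheory in
/-- Differential inequality for the moment generating function of the generalization gap. -/
lemma integral_generalizationGap_mul_exp_le (hm : 1 ≤ m) (hℓ : Measurable (Function.uncurry ℓ))
    (h0 : ∀ p z, 0 ≤ ℓ p z) (hM : ∀ p z, ℓ p z ≤ M)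
    (hγ : ∀ p z i w w', ℓ p (Function.update z i w) ≤ ℓ p (Function.update z i w') + γ)
    {u : ℝ} (hu : 0 ≤ u) :
    ∫ z, generalizationGap P ℓ z * Real.exp (u * generalizationGap P ℓ z)
        ∂(Measure.pi fun _ : Fin m => P) ≤
      (γ + u * ((2 * γ + M / m) * M / 4)) *
        mgf (generalizationGap P ℓ) (Measure.pi fun _ : Fin m => P) u := by
  have hmpos : (0 : ℝ) < m := by exact_mod_cast hm
  set μ : Measure (Fin m → Ω) := Measure.pi fun _ : Fin m => P with hμ
  set Φ := generalizationGap P ℓ with hΦ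
  have hΦm : Measurable Φ := measurable_generalizationGap hℓ
  have hΦb := generalizationGap_mem_Icc (P := P) hm hℓ h0 hM
  set h : (Fin m → Ω) → ℝ := fun z => Real.exp (u * Φ z) with hh
  have hhm : Measurable h := Real.measurable_exp.comp (hΦm.const_mul u)
  have hhi : Integrable h μ :=
    integrable_exp_mul_of_mem_Icc hΦm.aemeasurable (ae_of_all _ hΦb)
  have hmul : ∀ {g : (Fin m → Ω) → ℝ} {c : ℝ}, Measurable g → (∀ z, |g z| ≤ c) →
      Integrable (fun z => h z * g z) μ := fun hg hc =>
    hhi.mul_bdd hg.aestronglyMeasurable (ae_of_all _ fun z => by simpa using hc z)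
  let S : Fin m → (Fin m → Ω) → Ω → ℝ := fun i z w => ℓ w (Function.update z i w)
  have hSm2 : ∀ i, Measurable (Function.uncurry (S i)) := fun i =>
    hℓ.comp (measurable_snd.prodMk measurable_update')
  have hSm : ∀ i z, Measurable (S i z) := fun i z => (hSm2 i).comp measurable_prodMk_left
  have hSi : ∀ i z, Integrable (S i z) P := fun i z =>
    .of_mem_Icc 0 M (hSm i z).aemeasurable (ae_of_all _ fun w => ⟨h0 _ _, hM _ _⟩)
  let Q : Fin m → (Fin m → Ω) → ℝ := fun i z => ∫ w, S i z w ∂P - ℓ (z i) z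
  have hQm : ∀ i, Measurable (Q i) := fun i =>
    ((hSm2 i).stronglyMeasurable.integral_prod_right').measurable.sub
      (measurable_loss_self hℓ i)
  have hQb : ∀ i z, |Q i z| ≤ M := fun i z => by
    have h1 : 0 ≤ ∫ w, S i z w ∂P := integral_nonneg fun p => h0 _ _
    have h2 : ∫ w, S i z w ∂P ≤ M := by
      simpa using integral_mono (hSi i z) (integrable_const M) fun p => hM _ _
    rw [abs_le]
    constructor <;> simp only [Q] <;> linarith [h0 (z i) z, hM (z i) z]
  have hpt : ∀ z, Φ z ≤ γ + (1 / (m : ℝ)) * ∑ i, Q i z := fun z => by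
    have h1 : ∀ i ∈ Finset.univ, ∫ p, ℓ p z ∂P - ℓ (z i) z ≤ γ + Q i z := fun i _ => by
      have h2 : ∀ p, ℓ p z ≤ S i z p + γ := fun p => by
        simpa using hγ p z i (z i) p
      have h3 := integral_mono (integrable_loss (P := P) hℓ h0 hM z)
        ((hSi i z).add (integrable_const γ)) h2
      simp only [Pi.add_apply] at h3
      rw [integral_add (hSi i z) (integrable_const γ)] at h3
      simp only [integral_const, probReal_univ, smul_eq_mul, one_mul] at h3
      simp only [Q]
      linarith
    have h4 := mul_le_mul_of_nonneg_left (Finset.sum_le_sum h1) (by positivity : (0 : ℝ) ≤ 1 / m)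
    simp only [Finset.sum_sub_distrib, Finset.sum_add_distrib, Finset.sum_const, Finset.card_univ,
      Fintype.card_fin, nsmul_eq_mul] at h4
    have h5 : ∀ a b : ℝ, (1 / (m : ℝ)) * (m * a - b) = a - 1 / m * b := fun a b => by field_simp
    have h6 : ∀ a b : ℝ, (1 / (m : ℝ)) * (m * a + b) = a + 1 / m * b := fun a b => by field_simp
    rw [h5, h6] at h4
    exact h4
  have hQint : ∀ i, ∫ z, h z * Q i z ∂μ ≤ u * (2 * γ + M / m) * M / 4 * ∫ z, h z ∂μ := by
    intro i
    have hmp : MeasurePreserving (fun q : (Fin m → Ω) × Ω => Function.update q.1 i q.2)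
      (μ.prod P) μ := measurePreserving_update_pi P i
    have hres : ∀ {g : (Fin m → Ω) → ℝ}, Measurable g → Integrable g μ →
        Integrable (fun z => ∫ w, g (Function.update z i w) ∂P) μ ∧
        ∫ z, g z ∂μ = ∫ z, ∫ w, g (Function.update z i w) ∂P ∂μ := fun {g} hg hgi => by
      have hgi' : Integrable (fun q : (Fin m → Ω) × Ω => g (Function.update q.1 i q.2))
          (μ.prod P) := hmp.integrable_comp_of_integrable hgi
      refine ⟨hgi'.integral_prod_left, ?_⟩
      rw [← integral_prod _ hgi', ← integral_map hmp.measurable.aemeasurable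
        hg.aestronglyMeasurable, hmp.map_eq]
    obtain ⟨hi1, he1⟩ := hres (hhm.mul (hQm i)) (hmul (hQm i) (hQb i))
    obtain ⟨hi2, he2⟩ := hres hhm hhi
    simp only [Pi.mul_apply] at he1 hi1
    rw [he1, he2, ← integral_const_mul]
    refine integral_mono hi1 (hi2.const_mul _) fun z => ?_
    have := integral_exp_mul_sub_le P (a := fun w => Φ (Function.update z i w)) (S := S i z)
      (hΦm.comp (measurable_update z)) (hSm i z) (r := 2 * γ + M / m) (M := M)
      (generalizationGap_update_sub_le hm hℓ h0 hM hγ z i) (fun _ => h0 _ _) (fun _ => hM _ _) hu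
    simpa [Q, S, h] using this
  calc ∫ z, Φ z * Real.exp (u * Φ z) ∂μ
      ≤ ∫ z, (γ * h z + (1 / (m : ℝ)) * ∑ i, h z * Q i z) ∂μ := by
        refine integral_mono ?_ ?_ fun z => ?_
        · simpa only [mul_comm] using hmul hΦm (fun z => abs_le.2 (hΦb z))
        · exact (hhi.const_mul γ).add
            ((integrable_finsetSum _ fun i _ => hmul (hQm i) (hQb i)).const_mul _)
        · have := mul_le_mul_of_nonneg_right (hpt z) (Real.exp_pos (u * Φ z)).le
          refine this.trans_eq ?_
          simp only [h, ← Finset.mul_sum]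
          ring
    _ = γ * ∫ z, h z ∂μ + (1 / (m : ℝ)) * ∑ i, ∫ z, h z * Q i z ∂μ := by
        rw [integral_add (hhi.const_mul γ)
          ((integrable_finsetSum _ fun i _ => hmul (hQm i) (hQb i)).const_mul _),
          integral_const_mul, integral_const_mul,
          integral_finsetSum _ fun i _ => hmul (hQm i) (hQb i)]
    _ ≤ γ * ∫ z, h z ∂μ + (1 / (m : ℝ)) *
          ∑ _i : Fin m, u * (2 * γ + M / m) * M / 4 * ∫ z, h z ∂μ := by
        gcongr with i _
        exact hQint i
    _ = (γ + u * ((2 * γ + M / m) * M / 4)) * mgf Φ μ u := by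
        simp only [mgf, Finset.sum_const, Finset.card_univ, Fintype.card_fin, nsmul_eq_mul, h]
        field_simp

open ProbabilityTheory in
lemma mgf_generalizationGap_le (hm : 1 ≤ m) (hℓ : Measurable (Function.uncurry ℓ))
    (h0 : ∀ p z, 0 ≤ ℓ p z) (hM : ∀ p z, ℓ p z ≤ M)
    (hγ : ∀ p z i w w', ℓ p (Function.update z i w) ≤ ℓ p (Function.update z i w') + γ)
    {u : ℝ} (hu : 0 ≤ u) :
    mgf (generalizationGap P ℓ) (Measure.pi fun _ : Fin m => P) u ≤
      Real.exp (u * γ + u ^ 2 * ((2 * γ + M / m) * M / 8)) := by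
  set μ : Measure (Fin m → Ω) := Measure.pi fun _ : Fin m => P with hμ
  set Φ := generalizationGap P ℓ with hΦ
  set V := (2 * γ + M / m) * M / 8 with hV
  have hset : integrableExpSet Φ μ = Set.univ := Set.eq_univ_of_forall fun t =>
    integrable_exp_mul_of_mem_Icc (measurable_generalizationGap hℓ).aemeasurable
      (ae_of_all _ (generalizationGap_mem_Icc hm hℓ h0 hM))
  have hmgf : ∀ t, HasDerivAt (mgf Φ μ) (∫ z, Φ z * Real.exp (t * Φ z) ∂μ) t := fun t =>
    hasDerivAt_mgf (by simp [hset])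
  have hexp : ∀ t : ℝ, HasDerivAt (fun t => Real.exp (-(t * γ + t ^ 2 * V)))
      (Real.exp (-(t * γ + t ^ 2 * V)) * -(γ + 2 * t * V)) t := fun t => by
    have := (((hasDerivAt_id t).mul_const γ).add ((hasDerivAt_pow 2 t).mul_const V)).neg.exp
    simpa using this
  have hd := fun t => (hmgf t).mul (hexp t)
  have hanti : AntitoneOn (mgf Φ μ * fun t => Real.exp (-(t * γ + t ^ 2 * V))) (Set.Ici 0) := by
    refine antitoneOn_of_deriv_nonpos (convex_Ici 0)
      (fun t _ => (hd t).continuousAt.continuousWithinAt)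
      (fun t _ => (hd t).differentiableAt.differentiableWithinAt) fun t ht => ?_
    rw [interior_Ici] at ht
    rw [(hd t).deriv]
    have h1 := integral_generalizationGap_mul_exp_le (P := P) hm hℓ h0 hM hγ (le_of_lt ht)
    rw [← hμ, ← hΦ] at h1
    have h2 := mul_le_mul_of_nonneg_right h1 (Real.exp_pos (-(t * γ + t ^ 2 * V))).le
    refine (add_le_add_left h2 _).trans_eq ?_
    rw [hV]
    ring
  have := hanti Set.self_mem_Ici hu hu
  simp only [Pi.mul_apply, mgf_zero, zero_mul, ne_eq, OfNat.ofNat_ne_zero, not_false_eq_true,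
    zero_pow, add_zero, neg_zero, Real.exp_zero, mul_one] at this
  rwa [Real.exp_neg, mul_inv_le_iff₀ (Real.exp_pos _), one_mul] at this

/-- Generalization bound for uniformly stable algorithms: `γ` bounds the change of the loss when
one sample point is replaced, and `M` bounds the loss. -/
lemma measureReal_generalizationGap_ge_le (hm : 1 ≤ m) (hℓ : Measurable (Function.uncurry ℓ))
    (h0 : ∀ p z, 0 ≤ ℓ p z) (hM : ∀ p z, ℓ p z ≤ M)
    (hγ : ∀ p z i w w', ℓ p (Function.update z i w) ≤ ℓ p (Function.update z i w') + γ)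
    {A s : ℝ} (hA : 0 < A) (hs : 0 ≤ s) (hMA : (2 * (m * γ) + M) * M ≤ A ^ 2) :
    (Measure.pi fun _ : Fin m => P).real {z | γ + A * s ≤ generalizationGap P ℓ z} ≤
      Real.exp (-2 * m * s ^ 2) := by
  have hmpos : (0 : ℝ) < m := by exact_mod_cast hm
  have hu : 0 ≤ 4 * m * s / A := by positivity
  refine (ProbabilityTheory.measure_ge_le_exp_mul_mgf _ hu
    (ProbabilityTheory.integrable_exp_mul_of_mem_Icc (measurable_generalizationGap hℓ).aemeasurable
      (ae_of_all _ (generalizationGap_mem_Icc hm hℓ h0 hM)))).trans ?_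
  refine (mul_le_mul_of_nonneg_left (mgf_generalizationGap_le hm hℓ h0 hM hγ hu)
    (Real.exp_pos _).le).trans ?_
  rw [← Real.exp_add, Real.exp_le_exp]
  have hV : (2 * γ + M / m) * M / 8 ≤ A ^ 2 / (8 * m) := by
    rw [le_div_iff₀ (by positivity)]
    refine le_trans (le_of_eq ?_) hMA
    field_simp
  have h1 := mul_le_mul_of_nonneg_left hV (sq_nonneg (4 * m * s / A))
  have h2 : (4 * m * s / A) ^ 2 * (A ^ 2 / (8 * m)) = 2 * m * s ^ 2 := by
    field_simp
    ring
  have h3 : 4 * m * s / A * (A * s) = 4 * m * s ^ 2 := by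
    field_simp
  nlinarith

end UniformStability

section RegularizedMinimizer

variable {H : Type*} [NormedAddCommGroup H] [InnerProductSpace ℝ H]

/-- Quadratic growth around a minimizer of a convex function plus a squared norm. -/
lemma add_mul_norm_sub_sq_le_of_isMin {φ : H → ℝ} (hφ : ConvexOn ℝ Set.univ φ) {lam : ℝ}
    (hlam : 0 ≤ lam) {f : H} (hf : ∀ g, φ f + lam * ‖f‖ ^ 2 ≤ φ g + lam * ‖g‖ ^ 2) (g : H) :
    φ f + lam * ‖f‖ ^ 2 + lam * ‖g - f‖ ^ 2 ≤ φ g + lam * ‖g‖ ^ 2 := by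
  set D := lam * ‖g - f‖ ^ 2 with hD
  have hD0 : 0 ≤ D := by positivity
  set B := φ g - φ f + 2 * lam * ⟪f, g - f⟫_ℝ with hB
  have hexpand : ∀ s : ℝ, ‖f + s • (g - f)‖ ^ 2 =
      ‖f‖ ^ 2 + 2 * s * ⟪f, g - f⟫_ℝ + s ^ 2 * ‖g - f‖ ^ 2 := fun s => by
    rw [norm_add_sq_real, real_inner_smul_right, norm_smul, mul_pow, Real.norm_eq_abs, sq_abs]
    ring
  have hs : ∀ s : ℝ, 0 < s → s ≤ 1 → 0 ≤ B + s * D := fun s hs0 hs1 => by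
    have h1 := hφ.2 (Set.mem_univ f) (Set.mem_univ g) (sub_nonneg.2 hs1) hs0.le (by ring)
    rw [show (1 - s) • f + s • g = f + s • (g - f) by module, smul_eq_mul, smul_eq_mul] at h1
    have h2 := hf (f + s • (g - f))
    rw [hexpand] at h2
    have h3 : 0 ≤ s * (B + s * D) := by
      rw [hB, hD]
      nlinarith
    exact nonneg_of_mul_nonneg_right h3 hs0
  have hB0 : 0 ≤ B := by
    by_contra! hneg
    have hden : 0 < -B + D + 1 := by linarith
    have h1 := hs (-B / (-B + D + 1)) (div_pos (by linarith) hden)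
      ((div_le_one hden).2 (by linarith))
    have h2 : -B / (-B + D + 1) * D < -B := by
      rw [div_mul_eq_mul_div, div_lt_iff₀ hden]
      nlinarith
    linarith
  have h1 := hexpand 1
  rw [one_smul, add_sub_cancel] at h1
  rw [h1]
  nlinarith

variable {Ω : Type*} {c : Ω → H → ℝ} {κ lam : ℝ} {m : ℕ}

/-- Replacing one sample point moves the minimizer of a regularized empirical risk by at most
`κ / (lam * m)`. -/
lemma norm_sub_le_of_isMin_update (hc : ∀ p, ConvexOn ℝ Set.univ (c p)) (hκ : 0 ≤ κ)
    (hlip : ∀ p f g, c p f ≤ c p g + κ * ‖f - g‖) (hlam : 0 < lam) (hm : 1 ≤ m)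
    (z : Fin m → Ω) (i : Fin m) (w w' : Ω) {f f' : H}
    (hf : ∀ g, (1 / (m : ℝ)) * ∑ k, c (Function.update z i w k) f + lam * ‖f‖ ^ 2 ≤
      (1 / (m : ℝ)) * ∑ k, c (Function.update z i w k) g + lam * ‖g‖ ^ 2)
    (hf' : ∀ g, (1 / (m : ℝ)) * ∑ k, c (Function.update z i w' k) f' + lam * ‖f'‖ ^ 2 ≤
      (1 / (m : ℝ)) * ∑ k, c (Function.update z i w' k) g + lam * ‖g‖ ^ 2) :
    ‖f - f'‖ ≤ κ / (lam * m) := by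
  have hmpos : (0 : ℝ) < m := by exact_mod_cast hm
  have hconv : ∀ y : Fin m → Ω, ConvexOn ℝ Set.univ fun g => (1 / (m : ℝ)) * ∑ k, c (y k) g :=
    fun y => by
      refine ConvexOn.smul (c := 1 / (m : ℝ)) (by positivity) ?_
      refine ⟨convex_univ, fun a _ b _ s t hs ht hst => ?_⟩
      simp only [smul_eq_mul, Finset.mul_sum]
      rw [← Finset.sum_add_distrib]
      exact Finset.sum_le_sum fun k _ => (hc (y k)).2 trivial trivial hs ht hst
  have h1 := add_mul_norm_sub_sq_le_of_isMin (hconv _) hlam.le hf f'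
  have h2 := add_mul_norm_sub_sq_le_of_isMin (hconv _) hlam.le hf' f
  rw [norm_sub_rev] at h1
  have hsum : ∀ g, ∑ k, c (Function.update z i w k) g =
      ∑ k, c (Function.update z i w' k) g + (c w g - c w' g) := fun g => by
    rw [← sub_eq_iff_eq_add', ← Finset.sum_sub_distrib, Finset.sum_eq_single i]
    · simp
    · intro k _ hk
      simp [hk]
    · simp
  rw [hsum f, hsum f'] at h1
  have h3 := hlip w f' f
  have h4 := hlip w' f f'
  rw [norm_sub_rev] at h3
  have h5 : lam * ‖f - f'‖ ^ 2 ≤ 1 / (m : ℝ) * (κ * ‖f - f'‖) := by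
    have h6 : 1 / (m : ℝ) * (c w f' - c w f + (c w' f - c w' f')) ≤
        1 / (m : ℝ) * (2 * (κ * ‖f - f'‖)) :=
      mul_le_mul_of_nonneg_left (by linarith) (by positivity)
    linarith
  rcases (norm_nonneg (f - f')).eq_or_lt with h0 | h0
  · rw [← h0]
    positivity
  · rw [le_div_iff₀ (by positivity)]
    refine le_of_mul_le_mul_right ?_ h0
    have := mul_le_mul_of_nonneg_left h5 hmpos.le
    rw [← mul_assoc (m : ℝ) (1 / (m : ℝ)), mul_one_div_cancel hmpos.ne', one_mul] at this
    linarith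

end RegularizedMinimizer

/-- The minimizer of a regularized empirical risk has norm at most `κ / lam`. -/
lemma norm_le_of_isMin {H Ω : Type*} [NormedAddCommGroup H] {c : Ω → H → ℝ} {κ lam : ℝ} {m : ℕ}
    (hκ : 0 ≤ κ) (hlip : ∀ p f g, c p f ≤ c p g + κ * ‖f - g‖)
    (hlam : 0 < lam) (hm : 1 ≤ m) (z : Fin m → Ω) {f : H}
    (hf : ∀ g, (1 / (m : ℝ)) * ∑ k, c (z k) f + lam * ‖f‖ ^ 2 ≤
      (1 / (m : ℝ)) * ∑ k, c (z k) g + lam * ‖g‖ ^ 2) : ‖f‖ ≤ κ / lam := by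
  have hmpos : (0 : ℝ) < m := by exact_mod_cast hm
  have h1 := hf 0
  have h2 : ∑ k, c (z k) 0 ≤ ∑ k, c (z k) f + m * (κ * ‖f‖) := by
    refine (Finset.sum_le_sum fun k _ => hlip (z k) 0 f).trans_eq ?_
    simp [Finset.sum_add_distrib]
  have h3 := mul_le_mul_of_nonneg_left h2 (by positivity : (0 : ℝ) ≤ 1 / m)
  rw [mul_add, ← mul_assoc (1 / (m : ℝ)) (m : ℝ), one_div_mul_cancel hmpos.ne', one_mul] at h3
  rw [norm_zero] at h1
  rcases (norm_nonneg f).eq_or_lt with h0 | h0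
  · rw [← h0]
    positivity
  · rw [le_div_iff₀ hlam]
    refine le_of_mul_le_mul_right ?_ h0
    nlinarith

section EpsilonInsensitiveLoss

variable {Y H : Type*} [NormedAddCommGroup Y] [NormedSpace ℝ Y] [NormedAddCommGroup H]
  [NormedSpace ℝ H]

lemma convexOn_epsInsensitive (L : H →L[ℝ] Y) (y : Y) (ε : ℝ) :
    ConvexOn ℝ Set.univ fun f => max (‖y - L f‖ - ε) 0 := by
  have h1 : ConvexOn ℝ Set.univ fun f => ‖y - L f‖ := by
    refine ⟨convex_univ, fun a _ b _ s t hs ht hst => ?_⟩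
    have h : y - L (s • a + t • b) = s • (y - L a) + t • (y - L b) := by
      obtain rfl : s = 1 - t := by linarith
      simp only [map_add, map_smul]
      module
    simp only [h]
    refine (norm_add_le _ _).trans_eq ?_
    rw [norm_smul, norm_smul, Real.norm_of_nonneg hs, Real.norm_of_nonneg ht]
    rfl
  exact (h1.sub (concaveOn_const ε convex_univ)).sup (convexOn_const 0 convex_univ)

lemma epsInsensitive_le_add {L : H →L[ℝ] Y} {κ : ℝ} (hL : ∀ f, ‖L f‖ ≤ κ * ‖f‖) (y : Y) (ε : ℝ)
    (f g : H) : max (‖y - L f‖ - ε) 0 ≤ max (‖y - L g‖ - ε) 0 + κ * ‖f - g‖ := by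
  have h1 : ‖y - L f‖ ≤ ‖y - L g‖ + ‖L (f - g)‖ := by
    rw [map_sub, norm_sub_rev (L f)]
    simpa using norm_add_le (y - L g) (L g - L f)
  have h2 := hL (f - g)
  have h3 := (norm_nonneg _).trans h2
  refine max_le ?_ ?_
  · linarith [le_max_left (‖y - L g‖ - ε) 0]
  · linarith [le_max_right (‖y - L g‖ - ε) 0]

end EpsilonInsensitiveLoss

/-- Generalization bound for vector-valued support vector regression with the
ε-insensitive loss: with probability at least `1 − δ` over an i.i.d. sample of size `m`,
the expected loss of the regularized minimizer is bounded by its empirical risk plus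
`(1/m)·κ²/λ + (1/√m)·(2κ²/λ + C_y(1 + κ/√λ))·√(ln(1/δ)/2)`. -/
theorem stmt12 {X : Type*} [MeasurableSpace X]
    {Y : Type*} [NormedAddCommGroup Y] [InnerProductSpace ℝ Y]
    [MeasurableSpace Y] [BorelSpace Y] [SecondCountableTopology Y] [CompleteSpace Y]
    {H : Type*} [NormedAddCommGroup H] [InnerProductSpace ℝ H]
    [MeasurableSpace H] [BorelSpace H] [SecondCountableTopology H] [CompleteSpace H]
    (P : Measure (X × Y)) [IsProbabilityMeasure P]
    (ev : X → (H →L[ℝ] Y)) (κ lam Cy ε : ℝ)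
    (hκ : 0 < κ) (hlam : 0 < lam) (hCy : 0 < Cy) (hε : 0 ≤ ε)
    (hev : ∀ (x : X) (f : H), ‖ev x f‖ ≤ κ * ‖f‖)
    (hae : ∀ᵐ p ∂P, ‖p.2‖ ≤ Cy)
    (F : (n : ℕ) → (Fin n → X × Y) → H)
    (hmin : ∀ (n : ℕ) (z : Fin n → X × Y), (∀ k, ‖(z k).2‖ ≤ Cy) →
      (∀ g : H,
        (1 / (n : ℝ)) * ∑ k, max (‖(z k).2 - ev (z k).1 (F n z)‖ - ε) 0
            + lam * ‖F n z‖ ^ 2 ≤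
        (1 / (n : ℝ)) * ∑ k, max (‖(z k).2 - ev (z k).1 g‖ - ε) 0 + lam * ‖g‖ ^ 2) ∧
      (∀ f : H,
        (∀ g : H,
          (1 / (n : ℝ)) * ∑ k, max (‖(z k).2 - ev (z k).1 f‖ - ε) 0 + lam * ‖f‖ ^ 2 ≤
          (1 / (n : ℝ)) * ∑ k, max (‖(z k).2 - ev (z k).1 g‖ - ε) 0 + lam * ‖g‖ ^ 2) →
        f = F n z))
    (hFmeas : ∀ n : ℕ, Measurable (F n))
    (hLmeas : ∀ n : ℕ, Measurable (fun p : (X × Y) × (Fin n → X × Y) =>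
      max (‖p.1.2 - ev p.1.1 (F n p.2)‖ - ε) 0))
    (m : ℕ) (hm : 1 ≤ m) (δ : ℝ) (hδ0 : 0 < δ) (hδ1 : δ ≤ 1) :
    ENNReal.ofReal (1 - δ) ≤
      (Measure.pi fun _ : Fin m => P)
        {z | ∫ p, max (‖p.2 - ev p.1 (F m z)‖ - ε) 0 ∂P ≤
          (1 / (m : ℝ)) * ∑ k, max (‖(z k).2 - ev (z k).1 (F m z)‖ - ε) 0 +
          (1 / (m : ℝ)) * (κ ^ 2 / lam) +
          (1 / Real.sqrt m) *
            (2 * κ ^ 2 / lam + Cy * (1 + κ / Real.sqrt lam)) *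
            Real.sqrt (Real.log (1 / δ) / 2)} := by
  classical
  have hmpos : (0 : ℝ) < m := by exact_mod_cast hm
  set μ : Measure (Fin m → X × Y) := Measure.pi fun _ : Fin m => P with hμ
  let c : X × Y → H → ℝ := fun p f => max (‖p.2 - ev p.1 f‖ - ε) 0
  have hconv : ∀ p, ConvexOn ℝ Set.univ (c p) := fun p => convexOn_epsInsensitive (ev p.1) p.2 ε
  have hlip : ∀ p f g, c p f ≤ c p g + κ * ‖f - g‖ := fun p f g =>
    epsInsensitive_le_add (hev p.1) p.2 ε f g
  obtain ⟨p₀, hp₀⟩ := hae.exists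
  let T : X × Y → X × Y := fun p => if ‖p.2‖ ≤ Cy then p else p₀
  have hT : ∀ p, ‖(T p).2‖ ≤ Cy := fun p => by
    by_cases hp : ‖p.2‖ ≤ Cy <;> simp [T, hp, hp₀]
  have hTeq : ∀ {p : X × Y}, ‖p.2‖ ≤ Cy → T p = p := fun hp => if_pos hp
  have hTm : Measurable T :=
    Measurable.ite (measurableSet_le measurable_snd.norm measurable_const) measurable_id
      measurable_const
  let ℓ : X × Y → (Fin m → X × Y) → ℝ := fun p z => c (T p) (F m fun k => T (z k))
  have hmin' : ∀ z : Fin m → X × Y, ∀ g, (1 / (m : ℝ)) * ∑ k, c (T (z k)) (F m fun k => T (z k)) +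
      lam * ‖F m fun k => T (z k)‖ ^ 2 ≤ (1 / (m : ℝ)) * ∑ k, c (T (z k)) g + lam * ‖g‖ ^ 2 :=
    fun z => (hmin m (fun k => T (z k)) fun k => hT (z k)).1
  have hℓ : Measurable (Function.uncurry ℓ) :=
    (hLmeas m).comp ((hTm.comp measurable_fst).prodMk (measurable_pi_iff.2 fun k =>
      hTm.comp ((measurable_pi_apply k).comp measurable_snd)))
  set t := κ ^ 2 / lam with ht
  have ht0 : 0 < t := by positivity
  have h0 : ∀ p z, 0 ≤ ℓ p z := fun p z => le_max_right _ _
  have hM : ∀ p z, ℓ p z ≤ Cy + t := fun p z => by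
    have h1 := norm_le_of_isMin hκ.le (fun q => hlip (T q)) hlam hm z (hmin' z)
    have h2 := hlip (T p) (F m fun k => T (z k)) 0
    have h3 : c (T p) 0 ≤ Cy := by
      simp only [c, map_zero, sub_zero]
      exact max_le (by linarith [hT p]) hCy.le
    have h4 := mul_le_mul_of_nonneg_left h1 hκ.le
    rw [sub_zero] at h2
    have h5 : κ * (κ / lam) = t := by rw [ht]; ring
    simp only [ℓ]
    linarith
  have hγ : ∀ p z i w w', ℓ p (Function.update z i w) ≤ ℓ p (Function.update z i w') + t / m :=
    fun p z i w w' => by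
      have h1 := norm_sub_le_of_isMin_update (fun q => hconv (T q)) hκ.le (fun q => hlip (T q))
        hlam hm z i w w' (hmin' _) (hmin' _)
      have h2 := mul_le_mul_of_nonneg_left h1 hκ.le
      have h3 : κ * (κ / (lam * m)) = t / m := by rw [ht]; field_simp
      rw [h3] at h2
      exact (hlip (T p) _ _).trans (by simpa only [ℓ] using add_le_add_right h2 _)
  set A := 2 * κ ^ 2 / lam + Cy * (1 + κ / Real.sqrt lam) with hA
  have hAle : 2 * t + Cy ≤ A := by
    have : 0 ≤ Cy * (κ / Real.sqrt lam) := by positivity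
    rw [hA, ht, mul_add, mul_one, mul_div_assoc]
    linarith
  have hMA : (2 * (m * (t / m)) + (Cy + t)) * (Cy + t) ≤ A ^ 2 := by
    rw [mul_div_cancel₀ _ hmpos.ne']
    nlinarith
  set s := Real.sqrt (Real.log (1 / δ) / 2) / Real.sqrt m with hs
  have hs0 : 0 ≤ s := by positivity
  have hlog : 0 ≤ Real.log (1 / δ) := Real.log_nonneg (by rw [le_div_iff₀ hδ0]; linarith)
  have hexp : Real.exp (-2 * m * s ^ 2) = δ := by
    have : -2 * m * s ^ 2 = Real.log δ := by
      rw [hs, div_pow, Real.sq_sqrt (by positivity), Real.sq_sqrt hmpos.le, one_div, Real.log_inv]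
      field_simp
    rw [this, Real.exp_log hδ0]
  have hbad := measureReal_generalizationGap_ge_le (P := P) hm hℓ h0 hM hγ (by linarith) hs0 hMA
  rw [hexp, ← hμ] at hbad
  set B := {z | t / m + A * s ≤ generalizationGap P ℓ z} with hB
  have hBm : MeasurableSet B := measurableSet_le measurable_const (measurable_generalizationGap hℓ)
  have hgood : ENNReal.ofReal (1 - δ) ≤ μ Bᶜ := by
    rw [← ofReal_measureReal, probReal_compl_eq_one_sub hBm]
    exact ENNReal.ofReal_le_ofReal (by linarith)
  refine hgood.trans (measure_mono_ae ?_)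
  have haez : ∀ᵐ z ∂μ, ∀ k, ‖(z k).2‖ ≤ Cy := ae_all_iff.2 fun k =>
    (measurePreserving_eval (fun _ : Fin m => P) k).quasiMeasurePreserving.ae hae
  filter_upwards [haez] with z hz hzB
  have hzB' : generalizationGap P ℓ z < t / m + A * s := not_le.1 hzB
  have hTz : (fun k => T (z k)) = z := funext fun k => hTeq (hz k)
  have hint : ∫ p, ℓ p z ∂P = ∫ p, max (‖p.2 - ev p.1 (F m z)‖ - ε) 0 ∂P := by
    refine integral_congr_ae ?_
    filter_upwards [hae] with p hp
    simp only [ℓ, c, hTz, hTeq hp]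
  have hsum : ∑ k, ℓ (z k) z = ∑ k, max (‖(z k).2 - ev (z k).1 (F m z)‖ - ε) 0 :=
    Finset.sum_congr rfl fun k _ => by simp only [ℓ, c, hTz, hTeq (hz k)]
  unfold generalizationGap at hzB'
  rw [hint, hsum] at hzB'
  have h1 : 1 / Real.sqrt m * A * Real.sqrt (Real.log (1 / δ) / 2) = A * s := by
    rw [hs]
    ring
  have h2 : 1 / (m : ℝ) * t = t / m := by ring
  change _ ≤ _
  rw [h1, h2]
  linarith
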